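/- arXiv:1612.01391 — 2 statements merged into one kernel-verified Lean document; each statement's English description precedes it below -/
import Mathlib

section
/- For any real K > 0 and integer j = ⌊K⌋ + h with h ∈ ℕ, h ≥ 1, the generalized binomial coefficient satisfies |C(K, j)| ≤ 2^{K+1}. -/
/-- The generalized binomial coefficient `C(K,j) = K(K−1)⋯(K−j+1)/j!`. -/
noncomputable def rbinom (K : ℝ) (j : ℕ) : ℝ :=
  (∏ i ∈ Finset.range j, (K - i)) / (Nat.factorial j)

theorem rbinom_succ (K : ℝ) (j : ℕ) : rbinom K (j + 1) = rbinom K j * ((K - j) / (j + 1)) := by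
  unfold rbinom
  rw [Finset.prod_range_succ, Nat.factorial_succ, div_mul_div_comm]
  push_cast
  rw [mul_comm (Nat.factorial j : ℝ)]

theorem abs_rbinom_floor_succ_le_one {K : ℝ} (hK : 0 ≤ K) : |rbinom K (⌊K⌋₊ + 1)| ≤ 1 := by
  have hfloor := Nat.floor_le hK
  have hlt := Nat.lt_floor_add_one K
  have hmem : ∀ i ∈ Finset.range (⌊K⌋₊ + 1), (i : ℝ) ≤ ⌊K⌋₊ := fun i hi => by
    exact_mod_cast Nat.lt_succ_iff.mp (Finset.mem_range.mp hi)
  unfold rbinom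
  rw [abs_div, Nat.abs_cast, div_le_one (by positivity), Finset.abs_prod,
    ← Nat.descFactorial_self, Nat.descFactorial_eq_prod_range, Nat.cast_prod]
  refine Finset.prod_le_prod (fun _ _ => abs_nonneg _) fun i hi => ?_
  have hi' := hmem i hi
  rw [Nat.cast_sub (Finset.mem_range.mp hi).le, abs_of_nonneg (by linarith)]
  push_cast
  linarith

theorem abs_rbinom_floor_add_succ_le_one {K : ℝ} (hK : 0 ≤ K) (m : ℕ) :
    |rbinom K (⌊K⌋₊ + (m + 1))| ≤ 1 := by
  induction m with
  | zero => exact abs_rbinom_floor_succ_le_one hK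
  | succ m ih =>
    have hlt := Nat.lt_floor_add_one K
    rw [← add_assoc, rbinom_succ, abs_mul]
    refine mul_le_one₀ ih (abs_nonneg _) ?_
    rw [abs_div, abs_of_pos (by positivity : (0 : ℝ) < ((⌊K⌋₊ + (m + 1) : ℕ) : ℝ) + 1),
      div_le_one (by positivity), abs_le]
    push_cast
    constructor <;> linarith [(Nat.cast_nonneg m : (0 : ℝ) ≤ m)]

theorem rbinom_tail_le (K : ℝ) (hK : 0 < K) (h : ℕ) (hh : 1 ≤ h) :
    |rbinom K (⌊K⌋₊ + h)| ≤ (2 : ℝ) ^ (K + 1) := by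
  obtain ⟨m, rfl⟩ := Nat.exists_eq_add_of_le' hh
  exact (abs_rbinom_floor_add_succ_le_one hK.le m).trans
    (Real.one_le_rpow one_le_two (by linarith))
end

section
/- There is an absolute constant C > 0 such that for all real K > 0, ∫_0^1 |g(x)|^K dx = (e^γ/π) Γ(K+1) (1 + O(exp(−CK))) as K → ∞, where g(x) = Σ_{l≥1} (1 − 2{lx})/l and γ is the Euler–Mascheroni constant. -/
open MeasureTheory Set Filter

/-- `g(x) = Σ_{l≥1} (1 − 2{lx})/l`, defined as the limit of its partial sums. -/
noncomputable def gfun (x : ℝ) : ℝ :=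
  limUnder atTop (fun N => ∑ l ∈ Finset.range N, (1 - 2 * Int.fract ((l + 1) * x)) / (l + 1))

open Topology in
/-- Second-order asymptotics of the harmonic numbers, with an explicit error term. -/
theorem abs_harmonic_sub_log_sub_le (n : ℕ) (hn : 1 ≤ n) :
    |(harmonic n : ℝ) - Real.log n - Real.eulerMascheroniConstant - 1 / (2 * n)| ≤
      1 / (n : ℝ) ^ 2 := by
  set u : ℕ → ℝ := fun k => (harmonic (k + 1) : ℝ) - Real.log (k + 1 : ℕ) -
    1 / (2 * ((k : ℝ) + 1)) with hu
  have step : ∀ k : ℕ, |u (k + 1) - u k| ≤ 1 / ((k : ℝ) + 1) ^ 2 - 1 / ((k : ℝ) + 2) ^ 2 := by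
    intro k
    have hk : (0 : ℝ) ≤ k := Nat.cast_nonneg k
    have hx : |1 / ((k : ℝ) + 2)| < 1 := by
      rw [abs_of_nonneg (by positivity), div_lt_one (by positivity)]; linarith
    have h := Real.abs_log_sub_add_sum_range_le hx 2
    have hlog : Real.log (1 - 1 / ((k : ℝ) + 2)) = Real.log (k + 1) - Real.log (k + 2) := by
      rw [← Real.log_div (by positivity) (by positivity)]
      congr 1; field_simp; ring
    rw [hlog, abs_of_nonneg (by positivity : (0 : ℝ) ≤ 1 / ((k : ℝ) + 2))] at h
    simp only [Finset.sum_range_succ, Finset.sum_range_zero] at h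
    have hd : u (k + 1) - u k = (Real.log (k + 1) - Real.log (k + 2)) +
        (1 / ((k : ℝ) + 2) + (1 / ((k : ℝ) + 2)) ^ 2 / 2) +
        1 / (2 * ((k : ℝ) + 2) ^ 2 * (k + 1)) := by
      simp only [hu]
      rw [harmonic_succ (k + 1)]
      push_cast
      have e : (k : ℝ) + 1 + 1 = k + 2 := by ring
      rw [e]
      field_simp
      ring
    have hr : (1 / ((k : ℝ) + 2)) ^ (2 + 1) / (1 - 1 / ((k : ℝ) + 2)) =
        1 / (((k : ℝ) + 2) ^ 2 * (k + 1)) := by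
      have : 1 - 1 / ((k : ℝ) + 2) = (k + 1) / (k + 2) := by field_simp; ring
      rw [this, div_pow, one_pow]; field_simp
    rw [hr] at h
    have hb : 1 / (((k : ℝ) + 2) ^ 2 * (k + 1)) + 1 / (2 * ((k : ℝ) + 2) ^ 2 * (k + 1)) ≤
        1 / ((k : ℝ) + 1) ^ 2 - 1 / ((k : ℝ) + 2) ^ 2 := by
      have : 1 / ((k : ℝ) + 1) ^ 2 - 1 / ((k : ℝ) + 2) ^ 2 -
          (1 / (((k : ℝ) + 2) ^ 2 * (k + 1)) + 1 / (2 * ((k : ℝ) + 2) ^ 2 * (k + 1))) =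
          (k + 3) / (2 * ((k : ℝ) + 2) ^ 2 * (k + 1) ^ 2) := by field_simp; ring
      have h2 : 0 ≤ (k + 3) / (2 * ((k : ℝ) + 2) ^ 2 * (k + 1) ^ 2) := by positivity
      linarith
    rw [hd]
    refine (abs_add_le _ _).trans ?_
    rw [abs_of_nonneg (by positivity : 0 ≤ 1 / (2 * ((k : ℝ) + 2) ^ 2 * (k + 1)))]
    refine le_trans (add_le_add_left ?_ _) hb
    refine le_trans (le_of_eq ?_) h
    congr 1
    push_cast
    ring
  have hinv : Tendsto (fun k : ℕ => 1 / ((k : ℝ) + 1)) atTop (𝓝 0) :=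
    tendsto_one_div_add_atTop_nhds_zero_nat
  have hinv2 : Tendsto (fun k : ℕ => 1 / ((k : ℝ) + 1) ^ 2) atTop (𝓝 0) := by
    simpa [div_pow] using hinv.pow 2
  have hlim : Tendsto u atTop (𝓝 Real.eulerMascheroniConstant) := by
    have h1 := (tendsto_add_atTop_iff_nat 1).2 Real.tendsto_harmonic_sub_log
    have h2 := h1.sub (hinv.const_mul (1 / 2))
    simp only [mul_zero, sub_zero] at h2
    refine h2.congr fun k => ?_
    simp only [hu]
    congr 1
    field_simp
  have anti : Antitone fun k => u k + 1 / ((k : ℝ) + 1) ^ 2 := by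
    refine antitone_nat_of_succ_le fun k => ?_
    have := (abs_le.1 (step k)).2
    push_cast
    rw [show (k : ℝ) + 1 + 1 = k + 2 by ring]
    linarith
  have mono : Monotone fun k => u k - 1 / ((k : ℝ) + 1) ^ 2 := by
    refine monotone_nat_of_le_succ fun k => ?_
    have := (abs_le.1 (step k)).1
    push_cast
    rw [show (k : ℝ) + 1 + 1 = k + 2 by ring]
    linarith
  obtain ⟨k, rfl⟩ : ∃ k, n = k + 1 := ⟨n - 1, by omega⟩
  have h1 := anti.le_of_tendsto (by simpa using hlim.add hinv2) k
  have h2 := mono.ge_of_tendsto (by simpa using hlim.sub hinv2) k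
  simp only [hu] at h1 h2
  rw [abs_le]
  push_cast at *
  constructor <;> linarith

/-- Asymptotics of the harmonic numbers at integer parts of real numbers. -/
theorem abs_harmonic_floor_sub_le (y : ℝ) (hy : 1 ≤ y) :
    |(harmonic ⌊y⌋₊ : ℝ) - Real.log y - Real.eulerMascheroniConstant -
      (1 - 2 * Int.fract y) / (2 * y)| ≤ 6 / y ^ 2 := by
  set n := ⌊y⌋₊ with hn
  have hn1 : 1 ≤ n := (Nat.one_le_floor_iff _).2 hy
  have hnR : (1 : ℝ) ≤ n := by exact_mod_cast hn1
  obtain ⟨t, ht⟩ : ∃ t, t = Int.fract y := ⟨_, rfl⟩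
  have hyt : y = n + t := by
    rw [ht, hn, natCast_floor_eq_intCast_floor (by linarith), Int.floor_add_fract]
  have ht0 : 0 ≤ t := ht ▸ Int.fract_nonneg y
  have ht1 : t < 1 := ht ▸ Int.fract_lt_one y
  have h1 := abs_harmonic_sub_log_sub_le n hn1
  rw [← ht]
  have hlog : Real.log y = Real.log n + Real.log (1 + t / n) := by
    rw [← Real.log_mul (by positivity) (by positivity), hyt]
    congr 1; field_simp
  have hp : 0 < 1 + t / n := by positivity
  have hu := Real.log_le_sub_one_of_pos hp
  have hl := Real.one_sub_inv_le_log_of_pos hp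
  have hl' : 1 - (1 + t / n)⁻¹ = t / (n + t) := by field_simp; ring
  rw [hl'] at hl
  have hA : 1 / (2 * (n : ℝ)) - (1 - 2 * t) / (2 * y) = t / (n + t) + t / (2 * n * (n + t)) := by
    rw [hyt]; field_simp; ring
  have hB : 1 / (2 * (n : ℝ)) - (1 - 2 * t) / (2 * y) =
      t / n + t * (1 - 2 * t) / (2 * n * (n + t)) := by
    rw [hyt]; field_simp; ring
  have hC : t / (2 * n * (n + t)) ≤ 1 / (2 * (n : ℝ) ^ 2) := by
    rw [div_le_div_iff₀ (by positivity) (by positivity)]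
    nlinarith [mul_nonneg ht0 (by linarith : (0 : ℝ) ≤ n), mul_pos (by linarith : (0 : ℝ) < n) (by linarith : (0 : ℝ) < n)]
  have hD : -(1 / (2 * (n : ℝ) ^ 2)) ≤ t * (1 - 2 * t) / (2 * n * (n + t)) := by
    have : -(t / (2 * n * (n + t))) ≤ t * (1 - 2 * t) / (2 * n * (n + t)) := by
      rw [← neg_div]
      gcongr
      nlinarith
    linarith
  have hE : 3 / 2 * (1 / (n : ℝ) ^ 2) ≤ 6 / y ^ 2 := by
    rw [mul_one_div, div_div, div_le_div_iff₀ (by positivity) (by positivity)]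
    have : y ≤ 2 * n := by linarith
    nlinarith [mul_self_le_mul_self (by linarith) this]
  have hF : 1 / (2 * (n : ℝ) ^ 2) = 1 / 2 * (1 / (n : ℝ) ^ 2) := by field_simp
  rw [hF] at hC hD
  rw [abs_le] at h1 ⊢
  constructor <;> linarith [h1.1, h1.2]

/-- The partial sums of `gfun`. -/
noncomputable def gPartial (N : ℕ) (x : ℝ) : ℝ :=
  ∑ l ∈ Finset.range N, (1 - 2 * Int.fract ((l + 1) * x)) / (l + 1)

theorem sum_floor_div_eq {x : ℝ} (hx : Irrational x) (hx0 : 0 < x) (N : ℕ) :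
    ∑ l ∈ Finset.range N, (⌊((l : ℝ) + 1) * x⌋₊ : ℝ) / (l + 1) =
      ∑ m ∈ Finset.range ⌊N * x⌋₊, ((harmonic N : ℝ) - harmonic ⌊((m : ℝ) + 1) / x⌋₊) := by
  induction N with
  | zero => simp
  | succ N ih =>
    have hle : ⌊(N : ℝ) * x⌋₊ ≤ ⌊((N + 1 : ℕ) : ℝ) * x⌋₊ := by
      gcongr; simp
    rw [Finset.sum_range_succ, ih, ← Finset.sum_range_add_sum_Ico _ hle]
    have h2 : ∑ m ∈ Finset.Ico ⌊(N : ℝ) * x⌋₊ ⌊((N + 1 : ℕ) : ℝ) * x⌋₊,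
        ((harmonic (N + 1) : ℝ) - harmonic ⌊((m : ℝ) + 1) / x⌋₊) =
        ∑ m ∈ Finset.Ico ⌊(N : ℝ) * x⌋₊ ⌊((N + 1 : ℕ) : ℝ) * x⌋₊, 1 / ((N : ℝ) + 1) := by
      refine Finset.sum_congr rfl fun m hm => ?_
      rw [Finset.mem_Ico] at hm
      have h3 : (N : ℝ) * x < (m : ℝ) + 1 := by
        exact_mod_cast (Nat.floor_lt (by positivity)).1 (Nat.lt_succ_of_le hm.1)
      have h4 : (m : ℝ) + 1 ≤ ((N : ℝ) + 1) * x := by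
        have := (Nat.le_floor_iff (by positivity)).1 (Nat.succ_le_of_lt hm.2)
        exact_mod_cast this
      have h5 : (m : ℝ) + 1 ≠ ((N : ℝ) + 1) * x := by
        have := (hx.natCast_mul (Nat.succ_ne_zero N)).ne_nat (m + 1)
        intro h
        apply this
        push_cast
        exact h.symm
      have h6 : ⌊((m : ℝ) + 1) / x⌋₊ = N := by
        rw [Nat.floor_eq_iff (by positivity), le_div_iff₀ hx0, div_lt_iff₀ hx0]
        exact ⟨h3.le, lt_of_le_of_ne h4 h5⟩
      rw [h6, harmonic_succ]
      push_cast
      field_simp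
      ring
    rw [h2]
    have h7 : ∀ m : ℕ, ((harmonic (N + 1) : ℝ) - harmonic ⌊((m : ℝ) + 1) / x⌋₊) =
        ((harmonic N : ℝ) - harmonic ⌊((m : ℝ) + 1) / x⌋₊) + 1 / ((N : ℝ) + 1) := by
      intro m
      rw [harmonic_succ]
      push_cast
      ring
    simp only [h7, Finset.sum_add_distrib, Finset.sum_const, Nat.card_Ico, Finset.card_range,
      nsmul_eq_mul, Nat.cast_sub hle]
    push_cast
    ring

theorem gPartial_eq {x : ℝ} (hx : Irrational x) (hx0 : 0 < x) (N : ℕ) :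
    gPartial N x = harmonic N - 2 * N * x +
      2 * ∑ m ∈ Finset.range ⌊N * x⌋₊, ((harmonic N : ℝ) - harmonic ⌊((m : ℝ) + 1) / x⌋₊) := by
  rw [← sum_floor_div_eq hx hx0, gPartial, harmonic, Finset.mul_sum]
  have : (2 : ℝ) * N * x = ∑ l ∈ Finset.range N, 2 * x := by
    simp; ring
  rw [this]
  push_cast
  rw [← Finset.sum_sub_distrib, ← Finset.sum_add_distrib]
  refine Finset.sum_congr rfl fun l _ => ?_
  rw [natCast_floor_eq_intCast_floor (by positivity), Int.fract]
  field_simp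
  ring

theorem gPartial_fract (N : ℕ) (x : ℝ) : gPartial N (Int.fract x) = gPartial N x := by
  refine Finset.sum_congr rfl fun l _ => ?_
  have : ((l : ℝ) + 1) * Int.fract x = (l + 1) * x - (((l + 1 : ℤ) * ⌊x⌋ : ℤ) : ℝ) := by
    rw [Int.fract]; push_cast; ring
  rw [this, Int.fract_sub_intCast]

theorem gPartial_one_sub (N : ℕ) {x : ℝ} (hx : Irrational x) :
    gPartial N (1 - x) = -gPartial N x := by
  rw [gPartial, gPartial, ← Finset.sum_neg_distrib]
  refine Finset.sum_congr rfl fun l _ => ?_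
  have h1 : ((l : ℝ) + 1) * (1 - x) = -((l + 1) * x) + ((l + 1 : ℤ) : ℝ) := by
    push_cast; ring
  have h2 : Int.fract (((l : ℝ) + 1) * x) ≠ 0 := by
    intro h
    obtain ⟨z, hz⟩ := Int.fract_eq_zero_iff.1 h
    apply (hx.natCast_mul (Nat.succ_ne_zero l)).ne_int z
    push_cast
    exact hz.symm
  rw [h1, Int.fract_add_intCast, Int.fract_neg h2]
  ring

theorem abs_gPartial_le (N : ℕ) (x : ℝ) : |gPartial N x| ≤ harmonic N := by
  rw [gPartial, harmonic]
  push_cast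
  refine (Finset.abs_sum_le_sum_abs _ _).trans (Finset.sum_le_sum fun l _ => ?_)
  have hl : (0 : ℝ) < l + 1 := by positivity
  rw [abs_div, abs_of_pos hl, div_eq_mul_inv]
  refine mul_le_of_le_one_left (by positivity) ?_
  have := Int.fract_nonneg (((l : ℝ) + 1) * x)
  have := Int.fract_lt_one (((l : ℝ) + 1) * x)
  rw [abs_le]
  constructor <;> linarith

theorem abs_gPartial_mono_harmonic {M N : ℕ} (h : M ≤ N) (x : ℝ) :
    |gPartial M x| ≤ harmonic N := by
  refine (abs_gPartial_le M x).trans ?_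
  rw [harmonic, harmonic]
  push_cast
  exact Finset.sum_le_sum_of_subset_of_nonneg (by simpa using h) fun _ _ _ => by positivity

theorem measurable_gPartial (N : ℕ) : Measurable (gPartial N) := by
  unfold gPartial
  fun_prop

/-- The remainder in the second-order asymptotics of the harmonic numbers. -/
noncomputable def harmonicRem (y : ℝ) : ℝ :=
  (harmonic ⌊y⌋₊ : ℝ) - Real.log y - Real.eulerMascheroniConstant -
      (1 - 2 * Int.fract y) / (2 * y)

/-- The remainder in the reciprocity formula coming from the truncation of the series. -/
noncomputable def truncRem (N M : ℕ) (x : ℝ) : ℝ :=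
  (1 + 2 * M) * Real.log (N * x / M) - 2 * (N * x - M) +
    (1 + 2 * M) * (harmonic N - Real.log N - Real.eulerMascheroniConstant) -
    2 * (Real.log (Stirling.stirlingSeq M) - Real.log √Real.pi)

theorem gPartial_reciprocity {x : ℝ} (hx : Irrational x) (hx0 : 0 < x) {N M : ℕ}
    (hM : M = ⌊N * x⌋₊) (hM1 : 1 ≤ M) :
    gPartial N x + x * gPartial M (Int.fract (1 / x)) =
      -Real.log x + Real.eulerMascheroniConstant - Real.log (2 * Real.pi) + truncRem N M x -
        2 * ∑ m ∈ Finset.range M, harmonicRem ((m + 1) / x) := by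
  have hN : 0 < N := by
    rcases Nat.eq_zero_or_pos N with rfl | h
    · simp at hM; omega
    · exact h
  have hNR : (0 : ℝ) < N := by exact_mod_cast hN
  have hMR : (0 : ℝ) < M := by exact_mod_cast hM1
  have hlogfac : ∑ m ∈ Finset.range M, Real.log (m + 1) = Real.log M.factorial := by
    rw [← Finset.prod_range_add_one_eq_factorial]
    push_cast
    rw [Real.log_prod]
    intro i _
    positivity
  have hterm : ∀ m : ℕ, (harmonic ⌊((m : ℝ) + 1) / x⌋₊ : ℝ) =
      Real.log (m + 1) + (-Real.log x + Real.eulerMascheroniConstant) +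
      x / 2 * ((1 - 2 * Int.fract ((m + 1) * (1 / x))) / (m + 1)) +
      harmonicRem ((m + 1) / x) := by
    intro m
    have hm : (0 : ℝ) < m + 1 := by positivity
    rw [harmonicRem, Real.log_div hm.ne' hx0.ne', mul_one_div]
    field_simp
    ring
  have hst := Stirling.log_stirlingSeq_formula M
  rw [gPartial_eq hx hx0, gPartial_fract, gPartial, ← hM]
  simp only [hterm, Finset.sum_sub_distrib, Finset.sum_add_distrib, ← Finset.mul_sum, hlogfac,
    Finset.sum_const, Finset.card_range, nsmul_eq_mul]
  rw [truncRem, hst, Real.log_div (by positivity) (by positivity), Real.log_div (by positivity)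
    (by positivity), Real.log_mul (by positivity) (by positivity), Real.log_mul (by positivity)
    (by positivity), Real.log_mul (by positivity) (by positivity), Real.log_sqrt (by positivity),
    Real.log_exp]
  ring

theorem abs_harmonicRem_le {x : ℝ} (hx0 : 0 < x) (hx1 : x < 1) (m : ℕ) :
    |harmonicRem ((m + 1) / x)| ≤ 6 * x * (1 / ((m : ℝ) + 1) ^ 2) := by
  have hm : (1 : ℝ) ≤ m + 1 := by simp
  refine (abs_harmonic_floor_sub_le _ ?_).trans ?_
  · rw [le_div_iff₀ hx0]; linarith
  · rw [div_pow, mul_one_div, div_div_eq_mul_div]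
    gcongr
    nlinarith

theorem summable_one_div_succ_sq : Summable fun m : ℕ => 1 / ((m : ℝ) + 1) ^ 2 := by
  have := (summable_nat_add_iff 1).2 (Real.summable_one_div_nat_pow.2 one_lt_two)
  simpa using this

theorem abs_sum_harmonicRem_le {x : ℝ} (hx0 : 0 < x) (hx1 : x < 1) (M : ℕ) :
    |∑ m ∈ Finset.range M, harmonicRem ((m + 1) / x)| ≤
      6 * x * ∑' m : ℕ, 1 / ((m : ℝ) + 1) ^ 2 := by
  refine (Finset.abs_sum_le_sum_abs _ _).trans ?_
  refine (Finset.sum_le_sum fun m _ => abs_harmonicRem_le hx0 hx1 m).trans ?_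
  rw [← Finset.mul_sum]
  gcongr
  exact summable_one_div_succ_sq.sum_le_tsum _ fun _ _ => by positivity

theorem log_floor_bounds {y : ℝ} (hM1 : 1 ≤ ⌊y⌋₊) :
    0 ≤ Real.log (y / ⌊y⌋₊) ∧ Real.log (y / ⌊y⌋₊) ≤ 1 / ⌊y⌋₊ ∧
      |⌊y⌋₊ * Real.log (y / ⌊y⌋₊) - (y - ⌊y⌋₊)| ≤ 1 / y := by
  have hy1 : 1 ≤ y := (Nat.one_le_floor_iff _).1 hM1
  have hM : (1 : ℝ) ≤ ⌊y⌋₊ := by exact_mod_cast hM1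
  have h1 : (⌊y⌋₊ : ℝ) ≤ y := Nat.floor_le (by linarith)
  have h2 : y < ⌊y⌋₊ + 1 := Nat.lt_floor_add_one y
  generalize (⌊y⌋₊ : ℝ) = M at *
  have hz : 0 < y / M := by positivity
  have hu := Real.log_le_sub_one_of_pos hz
  have hl := Real.one_sub_inv_le_log_of_pos hz
  have e1 : y / M - 1 = (y - M) / M := by field_simp
  have e2 : 1 - (y / M)⁻¹ = (y - M) / y := by field_simp
  rw [e1] at hu
  rw [e2] at hl
  refine ⟨Real.log_nonneg (by rw [le_div_iff₀ (by linarith)]; linarith), hu.trans ?_, ?_⟩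
  · gcongr; linarith
  · rw [abs_le]
    rw [le_div_iff₀ (by linarith)] at hu
    have h3 := mul_le_mul_of_nonneg_left hl (by linarith : 0 ≤ M)
    have h4 : M * ((y - M) / y) = (y - M) - (y - M) ^ 2 / y := by field_simp; ring
    have h5 : (y - M) ^ 2 / y ≤ 1 / y := by gcongr; nlinarith
    have h6 : 0 ≤ 1 / y := by positivity
    constructor <;> linarith

theorem exists_abs_truncRem_le : ∃ C, ∀ x : ℝ, 0 < x → x < 1 → ∀ N : ℕ, 1 ≤ ⌊N * x⌋₊ →
    |truncRem N ⌊N * x⌋₊ x| ≤ C := by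
  have hst : Tendsto (fun M => Real.log (Stirling.stirlingSeq M)) atTop
      (nhds (Real.log √Real.pi)) :=
    Stirling.tendsto_stirlingSeq_sqrt_pi.log (by positivity)
  obtain ⟨B, hB⟩ := (Metric.isBounded_range_of_tendsto _ hst).exists_norm_le
  refine ⟨3 + 2 + 6 + 2 * (B + |Real.log √Real.pi|), fun x hx0 hx1 N hM1 => ?_⟩
  obtain ⟨h1, h2, h3⟩ := log_floor_bounds hM1
  have hMR : (1 : ℝ) ≤ ⌊N * x⌋₊ := by exact_mod_cast hM1
  have h4 : (⌊N * x⌋₊ : ℝ) ≤ N * x := Nat.floor_le (by positivity)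
  have h5 : (N : ℝ) * x < ⌊N * x⌋₊ + 1 := Nat.lt_floor_add_one _
  have hBM := hB _ (mem_range_self ⌊N * x⌋₊)
  rw [Real.norm_eq_abs] at hBM
  rw [truncRem]
  generalize Real.log (Stirling.stirlingSeq ⌊(N : ℝ) * x⌋₊) = s at *
  generalize (⌊(N : ℝ) * x⌋₊ : ℝ) = M at *
  have hN0 : 0 < (N : ℝ) := by by_contra h; nlinarith
  have hNR : (1 : ℝ) ≤ N := by nlinarith
  have hMN : M ≤ N := by nlinarith
  have hh := abs_harmonic_sub_log_sub_le N (by exact_mod_cast hNR)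
  have hh2 : |(harmonic N : ℝ) - Real.log N - Real.eulerMascheroniConstant| ≤ 2 / N := by
    have e1 : 1 / (N : ℝ) ^ 2 ≤ 1 / N := by gcongr; nlinarith
    have e2 : 1 / (2 * (N : ℝ)) ≤ 1 / N := by gcongr; linarith
    have e3 : 0 ≤ 1 / (2 * (N : ℝ)) := by positivity
    have e4 : 2 / (N : ℝ) = 1 / N + 1 / N := by ring
    rw [abs_le] at hh ⊢
    constructor <;> linarith [hh.1, hh.2]
  have b1 : |(1 + 2 * M) * Real.log (N * x / M)| ≤ 3 := by
    rw [abs_of_nonneg (by positivity)]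
    calc (1 + 2 * M) * Real.log (N * x / M) ≤ (3 * M) * (1 / M) := by
          gcongr; linarith
      _ = 3 := by field_simp
  have b2 : |2 * (N * x - M)| ≤ 2 := by rw [abs_le]; constructor <;> linarith
  have b3 : |(1 + 2 * M) * ((harmonic N : ℝ) - Real.log N - Real.eulerMascheroniConstant)| ≤ 6 := by
    rw [abs_mul, abs_of_nonneg (by linarith : 0 ≤ 1 + 2 * M)]
    calc (1 + 2 * M) * _ ≤ (3 * N) * (2 / N) := by
          gcongr; linarith
      _ = 6 := by field_simp; norm_num
  have b4 : |2 * (s - Real.log √Real.pi)| ≤ 2 * (B + |Real.log √Real.pi|) := by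
    rw [abs_mul, abs_two]
    gcongr
    exact (abs_sub _ _).trans (by linarith)
  refine (abs_sub _ _).trans (add_le_add ?_ b4)
  refine (abs_add_le _ _).trans (add_le_add ?_ b3)
  exact (abs_sub _ _).trans (add_le_add b1 b2)

open Topology in
theorem tendsto_truncRem {x : ℝ} (hx0 : 0 < x) :
    Tendsto (fun N : ℕ => truncRem N ⌊N * x⌋₊ x) atTop (𝓝 x) := by
  have hNx : Tendsto (fun N : ℕ => (N : ℝ) * x) atTop atTop :=
    tendsto_natCast_atTop_atTop.atTop_mul_const hx0
  have hM : Tendsto (fun N : ℕ => ⌊(N : ℝ) * x⌋₊) atTop atTop := tendsto_nat_floor_atTop.comp hNx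
  have hMR : Tendsto (fun N : ℕ => (⌊(N : ℝ) * x⌋₊ : ℝ)) atTop atTop :=
    tendsto_natCast_atTop_atTop.comp hM
  have hst : Tendsto (fun N : ℕ => Real.log (Stirling.stirlingSeq ⌊(N : ℝ) * x⌋₊) -
      Real.log √Real.pi) atTop (𝓝 0) := by
    have := (Stirling.tendsto_stirlingSeq_sqrt_pi.log (by positivity)).comp hM
    simpa using this.sub_const (Real.log √Real.pi)
  have hlog : Tendsto (fun N : ℕ => Real.log (N * x / ⌊(N : ℝ) * x⌋₊)) atTop (𝓝 0) := by
    refine tendsto_of_tendsto_of_tendsto_of_le_of_le' tendsto_const_nhds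
      (tendsto_const_nhds.div_atTop hMR : Tendsto (fun N : ℕ => (1 : ℝ) / _) _ _) ?_ ?_
    · filter_upwards [hM.eventually_ge_atTop 1] with N hN using (log_floor_bounds hN).1
    · filter_upwards [hM.eventually_ge_atTop 1] with N hN using (log_floor_bounds hN).2.1
  have hlog2 : Tendsto (fun N : ℕ => ⌊(N : ℝ) * x⌋₊ * Real.log (N * x / ⌊(N : ℝ) * x⌋₊) -
      (N * x - ⌊(N : ℝ) * x⌋₊)) atTop (𝓝 0) := by
    refine squeeze_zero_norm' ?_
      (tendsto_const_nhds.div_atTop hNx : Tendsto (fun N : ℕ => (1 : ℝ) / _) _ _)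
    filter_upwards [hM.eventually_ge_atTop 1] with N hN using (log_floor_bounds hN).2.2
  have hNinv : Tendsto (fun N : ℕ => 1 / (N : ℝ)) atTop (𝓝 0) := tendsto_one_div_atTop_nhds_zero_nat
  have hh : Tendsto (fun N : ℕ => (N : ℝ) *
      (harmonic N - Real.log N - Real.eulerMascheroniConstant)) atTop (𝓝 (1 / 2)) := by
    rw [tendsto_iff_norm_sub_tendsto_zero]
    refine squeeze_zero_norm' ?_ hNinv
    filter_upwards [eventually_ge_atTop 1] with N hN
    have hN' : (0 : ℝ) < N := by exact_mod_cast hN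
    have := mul_le_mul_of_nonneg_left (abs_harmonic_sub_log_sub_le N hN) hN'.le
    nth_rw 1 [← abs_of_pos hN'] at this
    rw [← abs_mul] at this
    have e1 : (N : ℝ) * (harmonic N - Real.log N - Real.eulerMascheroniConstant -
        1 / (2 * N)) = N * (harmonic N - Real.log N - Real.eulerMascheroniConstant) - 1 / 2 := by
      field_simp
    have e2 : (N : ℝ) * (1 / (N : ℝ) ^ 2) = 1 / N := by field_simp
    rw [e1, e2] at this
    rwa [norm_norm, Real.norm_eq_abs]
  have hfl : Tendsto (fun N : ℕ => (⌊(N : ℝ) * x⌋₊ : ℝ) / N) atTop (𝓝 x) := by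
    have := (tendsto_nat_floor_mul_div_atTop hx0.le).comp
      (tendsto_natCast_atTop_atTop (R := ℝ))
    refine this.congr fun N => ?_
    simp [mul_comm]
  have hmain := ((hlog.add (hlog2.const_mul 2)).add
    ((hNinv.add (hfl.const_mul 2)).mul hh)).sub (hst.const_mul 2)
  have : 0 + 2 * 0 + (0 + 2 * x) * (1 / 2) - 2 * 0 = x := by ring
  rw [this] at hmain
  refine hmain.congr' ?_
  filter_upwards [eventually_ge_atTop 1] with N hN
  have hN' : (0 : ℝ) < N := by exact_mod_cast hN
  rw [truncRem]
  field_simp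
  ring

/-- The main term of `gfun` near zero. -/
noncomputable def logTerm (x : ℝ) : ℝ :=
  -Real.log x + Real.eulerMascheroniConstant - Real.log (2 * Real.pi)

theorem exists_abs_gPartial_le : ∃ C, 0 < C ∧ ∀ x : ℝ, Irrational x → 0 < x → x < 1 → ∀ N : ℕ,
    ∃ M ≤ N, |gPartial N x| ≤ -Real.log x + C + x * |gPartial M (Int.fract (1 / x))| := by
  obtain ⟨C₁, hC₁⟩ := exists_abs_truncRem_le
  set Z : ℝ := ∑' m : ℕ, 1 / ((m : ℝ) + 1) ^ 2 with hZ
  have hZ0 : 0 ≤ Z := tsum_nonneg fun m => by positivity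
  refine ⟨1 + |Real.eulerMascheroniConstant - Real.log (2 * Real.pi)| + |C₁| + 12 * Z,
    by positivity, fun x hx hx0 hx1 N => ⟨⌊N * x⌋₊, ?_, ?_⟩⟩
  · refine Nat.floor_le_of_le ?_
    exact mul_le_of_le_one_right (Nat.cast_nonneg N) hx1.le
  have hlog : 0 ≤ -Real.log x := by linarith [Real.log_nonpos hx0.le hx1.le]
  rcases Nat.eq_zero_or_pos ⌊N * x⌋₊ with h0 | hM1
  · have hg : |gPartial N x| ≤ 1 - Real.log x := by
      refine (abs_gPartial_le N x).trans ((harmonic_le_one_add_log N).trans ?_)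
      rcases Nat.eq_zero_or_pos N with rfl | hN
      · simpa using hlog
      · have hN' : (0 : ℝ) < N := by exact_mod_cast hN
        have h1 : (N : ℝ) * x < 1 := Nat.floor_eq_zero.1 h0
        have := Real.log_nonpos (by positivity) h1.le
        rw [Real.log_mul hN'.ne' hx0.ne'] at this
        linarith
    have : 0 ≤ x * |gPartial ⌊N * x⌋₊ (Int.fract (1 / x))| := by positivity
    have : 0 ≤ |Real.eulerMascheroniConstant - Real.log (2 * Real.pi)| := abs_nonneg _
    have : 0 ≤ |C₁| := abs_nonneg _
    linarith
  · have h := gPartial_reciprocity hx hx0 rfl hM1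
    have h1 := (hC₁ x hx0 hx1 N hM1).trans (le_abs_self C₁)
    have h2 := abs_sum_harmonicRem_le hx0 hx1 ⌊N * x⌋₊
    rw [← hZ] at h2
    have h3 : 6 * x * Z ≤ 6 * Z := by nlinarith
    have h4 := abs_le.1 (le_refl |Real.eulerMascheroniConstant - Real.log (2 * Real.pi)|)
    have h5 := abs_le.1 (le_refl |gPartial ⌊N * x⌋₊ (Int.fract (1 / x))|)
    have h6 := mul_le_mul_of_nonneg_left h5.1 hx0.le
    have h7 := mul_le_mul_of_nonneg_left h5.2 hx0.le
    rw [abs_le] at h1 h2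
    rw [abs_le]
    constructor <;> linarith [h1.1, h1.2, h2.1, h2.2, h4.1, h4.2]

open Topology in
theorem exists_tendsto_gPartial_add : ∃ C, 0 < C ∧ ∀ x : ℝ, Irrational x → 0 < x → x < 1 →
    ∃ R, |R| ≤ C * x ∧ Tendsto (fun N : ℕ => gPartial N x +
      x * gPartial ⌊N * x⌋₊ (Int.fract (1 / x))) atTop (𝓝 (logTerm x + R)) := by
  set Z : ℝ := ∑' m : ℕ, 1 / ((m : ℝ) + 1) ^ 2 with hZ
  have hZ0 : 0 ≤ Z := tsum_nonneg fun m => by positivity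
  refine ⟨1 + 12 * Z, by positivity, fun x hx hx0 hx1 => ?_⟩
  have hsum : Summable fun m : ℕ => harmonicRem ((m + 1) / x) :=
    Summable.of_norm_bounded (summable_one_div_succ_sq.mul_left (6 * x))
      fun m => abs_harmonicRem_le hx0 hx1 m
  have hlim := hsum.hasSum.tendsto_sum_nat
  have hM : Tendsto (fun N : ℕ => ⌊(N : ℝ) * x⌋₊) atTop atTop :=
    tendsto_nat_floor_atTop.comp (tendsto_natCast_atTop_atTop.atTop_mul_const hx0)
  refine ⟨x - 2 * ∑' m : ℕ, harmonicRem ((m + 1) / x), ?_, ?_⟩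
  · have : |∑' m : ℕ, harmonicRem ((m + 1) / x)| ≤ 6 * x * Z :=
      le_of_tendsto hlim.abs (Eventually.of_forall fun M => abs_sum_harmonicRem_le hx0 hx1 M)
    rw [abs_le] at this ⊢
    constructor <;> linarith [this.1, this.2]
  · have h := ((tendsto_truncRem hx0).sub ((hlim.comp hM).const_mul 2)).const_add (logTerm x)
    refine h.congr' ?_
    filter_upwards [hM.eventually_ge_atTop 1] with N hN
    rw [gPartial_reciprocity hx hx0 rfl hN, logTerm]
    simp only [Function.comp]
    ring

theorem ae_irrational : ∀ᵐ x : ℝ, Irrational x :=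
  (countable_range ((↑) : ℚ → ℝ)).ae_notMem _

theorem lintegral_Ioo_zero_half_le (H : ℝ → ENNReal) :
    ∫⁻ x in Ioo (0 : ℝ) (1 / 2), H x ≤ ∑' n : ℕ, ∫⁻ t in Ioo (0 : ℝ) 1,
      ENNReal.ofReal (1 / ((n : ℝ) + 2 + t) ^ 2) * H (1 / ((n : ℝ) + 2 + t)) := by
  have hsub : (Ioo (0 : ℝ) (1 / 2)) ≤ᵐ[volume]
      ⋃ n : ℕ, (fun t : ℝ => 1 / ((n : ℝ) + 2 + t)) '' Ioo (0 : ℝ) 1 := by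
    filter_upwards [ae_irrational] with x hx hmem
    obtain ⟨h0, h1⟩ := (hmem : x ∈ Ioo (0 : ℝ) (1 / 2))
    refine mem_iUnion.2 ⟨⌊1 / x⌋₊ - 2, Int.fract (1 / x), ⟨?_, Int.fract_lt_one _⟩, ?_⟩
    · refine lt_of_le_of_ne (Int.fract_nonneg _) fun h => ?_
      obtain ⟨z, hz⟩ := Int.fract_eq_zero_iff.1 h.symm
      have hinv : Irrational (1 / x) := by simpa using hx
      exact hinv.ne_int z hz.symm
    · have h2 : 2 ≤ ⌊1 / x⌋₊ := by
        refine Nat.le_floor ?_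
        rw [le_div_iff₀ h0]
        push_cast
        linarith
      have h3 : ((⌊1 / x⌋₊ - 2 : ℕ) : ℝ) + 2 + Int.fract (1 / x) = 1 / x := by
        rw [Nat.cast_sub h2, natCast_floor_eq_intCast_floor (by positivity)]
        push_cast
        rw [sub_add_cancel, Int.floor_add_fract]
      simp only [h3, one_div_one_div]
  refine (lintegral_mono_set' hsub).trans ((lintegral_iUnion_le _ _).trans_eq ?_)
  congr 1
  ext n
  have hd : ∀ t ∈ Ioo (0 : ℝ) 1, HasDerivWithinAt (fun t : ℝ => 1 / ((n : ℝ) + 2 + t))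
      (-(1 / ((n : ℝ) + 2 + t) ^ 2)) (Ioo 0 1) t := by
    intro t ht
    have hne : (n : ℝ) + 2 + t ≠ 0 := by have := ht.1; positivity
    have := ((hasDerivAt_id t).const_add ((n : ℝ) + 2)).inv hne
    simp only [id, ← one_div] at this
    refine this.hasDerivWithinAt.congr_deriv ?_
    ring
  have hinj : InjOn (fun t : ℝ => 1 / ((n : ℝ) + 2 + t)) (Ioo 0 1) := by
    intro s hs t ht h
    simpa using h
  rw [lintegral_image_eq_lintegral_abs_deriv_mul measurableSet_Ioo hd hinj]
  refine lintegral_congr fun t => ?_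
  rw [abs_neg, abs_of_nonneg (by positivity)]

theorem lintegral_rpow_mul_fract_inv_le {b : ℝ} (hb2 : b ≤ 2) (F : ℝ → ENNReal) :
    ∫⁻ x in Ioo (0 : ℝ) (1 / 2), ENNReal.ofReal (x ^ (-b)) * F (Int.fract (1 / x)) ≤
      (∑' n : ℕ, ENNReal.ofReal (((n : ℝ) + 2) ^ (b - 2))) * ∫⁻ t in Ioo (0 : ℝ) 1, F t := by
  refine (lintegral_Ioo_zero_half_le _).trans ?_
  rw [← ENNReal.tsum_mul_right]
  refine ENNReal.tsum_le_tsum fun n => ?_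
  rw [← lintegral_const_mul' _ _ ENNReal.ofReal_ne_top]
  refine setLIntegral_mono' measurableSet_Ioo fun t ht => ?_
  have hp : 0 < (n : ℝ) + 2 + t := by have := ht.1; positivity
  have hfr : Int.fract (1 / (1 / ((n : ℝ) + 2 + t))) = t := by
    rw [one_div_one_div, add_assoc, Int.fract_natCast_add, add_comm,
      show (2 : ℝ) = ((2 : ℕ) : ℝ) by norm_num, Int.fract_add_natCast, Int.fract_eq_self]
    exact ⟨ht.1.le, ht.2⟩
  rw [hfr, ← mul_assoc, ← ENNReal.ofReal_mul (by positivity)]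
  gcongr
  have h1 : 1 / ((n : ℝ) + 2 + t) ^ 2 * (1 / ((n : ℝ) + 2 + t)) ^ (-b) =
      ((n : ℝ) + 2 + t) ^ (b - 2) := by
    rw [one_div, one_div, Real.inv_rpow hp.le, ← Real.rpow_neg hp.le, neg_neg,
      Real.rpow_sub hp, Real.rpow_two]
    ring
  rw [h1]
  exact Real.rpow_le_rpow_of_nonpos (by positivity) (by linarith [ht.1]) (by linarith)

theorem image_one_sub_Ioo_zero_half :
    (fun x : ℝ => 1 - x) '' Ioo (0 : ℝ) (1 / 2) = Ioo (1 / 2 : ℝ) 1 := by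
  rw [image_const_sub_Ioo]
  norm_num

theorem ae_Ioo_zero_one_le :
    (Ioo (0 : ℝ) 1) =ᵐ[volume] (Ioo (0 : ℝ) (1 / 2) ∪ Ioo (1 / 2 : ℝ) 1 : Set ℝ) := by
  have h : ∀ᵐ x : ℝ, x ∉ ({1 / 2} : Set ℝ) := (countable_singleton _).ae_notMem _
  filter_upwards [h] with x hx
  apply propext
  change x ∈ Ioo (0 : ℝ) 1 ↔ x ∈ Ioo (0 : ℝ) (1 / 2) ∪ Ioo (1 / 2 : ℝ) 1
  simp only [mem_singleton_iff, mem_union, mem_Ioo] at *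
  rcases lt_or_gt_of_ne hx with h | h <;> constructor
  · exact fun h' => Or.inl ⟨h'.1, h⟩
  · rintro (h' | h') <;> constructor <;> linarith
  · exact fun h' => Or.inr ⟨h, h'.2⟩
  · rintro (h' | h') <;> constructor <;> linarith

theorem lintegral_Ioo_zero_one_le_of_symm {F : ℝ → ENNReal}
    (hF : ∀ x, Irrational x → F (1 - x) = F x) :
    ∫⁻ x in Ioo (0 : ℝ) 1, F x ≤ 2 * ∫⁻ x in Ioo (0 : ℝ) (1 / 2), F x := by
  rw [setLIntegral_congr ae_Ioo_zero_one_le, two_mul]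
  refine (lintegral_union_le _ _ _).trans (add_le_add le_rfl (le_of_eq ?_))
  have hd : ∀ t ∈ Ioo (0 : ℝ) (1 / 2), HasDerivWithinAt (fun t : ℝ => 1 - t)
      (-1) (Ioo 0 (1 / 2)) t := fun t _ => ((hasDerivAt_id t).const_sub 1).hasDerivWithinAt
  rw [← image_one_sub_Ioo_zero_half, lintegral_image_eq_lintegral_abs_deriv_mul
    measurableSet_Ioo hd fun s _ t _ h => by simpa using h]
  refine setLIntegral_congr_fun_ae measurableSet_Ioo ?_
  filter_upwards [ae_irrational] with x hx _
  simp [hF x hx]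

/-- The exponential of the partial sums, as an extended nonnegative real. -/
noncomputable def expPartial (n : ℕ) (x : ℝ) : ENNReal :=
  ENNReal.ofReal (Real.exp (3 / 4 * |gPartial n x|))

/-- The maximum of `expPartial` over indices up to `N`. -/
noncomputable def expPartialMax (N : ℕ) (x : ℝ) : ENNReal :=
  (Finset.range (N + 1)).sup' Finset.nonempty_range_add_one fun n => expPartial n x

/-- The maximal function of `expPartial`. -/
noncomputable def expMaximal (x : ℝ) : ENNReal := ⨆ n, expPartial n x

theorem measurable_expPartial (n : ℕ) : Measurable (expPartial n) := by
  have := measurable_gPartial n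
  unfold expPartial
  fun_prop

theorem measurable_expMaximal : Measurable expMaximal :=
  .iSup measurable_expPartial

theorem lintegral_expPartialMax_lt_top (N : ℕ) :
    ∫⁻ x in Ioo (0 : ℝ) 1, expPartialMax N x < ⊤ := by
  have h : ∀ x, expPartialMax N x ≤ ENNReal.ofReal (Real.exp (3 / 4 * harmonic N)) := by
    intro x
    refine Finset.sup'_le _ _ fun n hn => ?_
    unfold expPartial
    gcongr
    exact abs_gPartial_mono_harmonic (Nat.lt_succ_iff.1 (Finset.mem_range.1 hn)) x
  refine (lintegral_mono h).trans_lt ?_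
  simp [ENNReal.ofReal_lt_top]

theorem expPartialMax_one_sub (N : ℕ) {x : ℝ} (hx : Irrational x) :
    expPartialMax N (1 - x) = expPartialMax N x := by
  simp only [expPartialMax, expPartial, gPartial_one_sub _ hx, abs_neg]

theorem summable_natCast_add_two_rpow {s : ℝ} (hs : s < -1) :
    Summable fun n : ℕ => ((n : ℝ) + 2) ^ s := by
  have := (summable_nat_add_iff 2).2 (Real.summable_nat_rpow.2 hs)
  simpa using this

theorem expPartialMax_le {C : ℝ} (hC : ∀ x : ℝ, Irrational x → 0 < x → x < 1 → ∀ N : ℕ,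
      ∃ M ≤ N, |gPartial N x| ≤ -Real.log x + C + x * |gPartial M (Int.fract (1 / x))|)
    {ε : ℝ} (hε : 0 < ε) (N : ℕ) {x : ℝ} (hx : Irrational x) (hx0 : 0 < x) (hx1 : x < 1 / 2) :
    expPartialMax N x ≤ ENNReal.ofReal (x ^ (-(3 / 4 : ℝ))) * (ENNReal.ofReal (Real.exp (3 / 4 * C))
      * (ENNReal.ofReal ε * expPartialMax N (Int.fract (1 / x)) + ENNReal.ofReal (1 / ε))) := by
  refine Finset.sup'_le _ _ fun n hn => ?_
  obtain ⟨m, hm, h⟩ := hC x hx hx0 (by linarith) n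
  have hmN : m ∈ Finset.range (N + 1) := by
    rw [Finset.mem_range] at *
    omega
  have hle : expPartial m (Int.fract (1 / x)) ≤ expPartialMax N (Int.fract (1 / x)) :=
    Finset.le_sup' (fun n => expPartial n (Int.fract (1 / x))) hmN
  refine le_trans ?_ (mul_le_mul_right (mul_le_mul_right
    (add_le_add_left (mul_le_mul_right hle _) _) _) _)
  rw [expPartial, expPartial, ← ENNReal.ofReal_mul hε.le, ← ENNReal.ofReal_add (by positivity)
    (by positivity), ← ENNReal.ofReal_mul (by positivity), ← ENNReal.ofReal_mul (by positivity)]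
  refine ENNReal.ofReal_le_ofReal ?_
  set s := |gPartial m (Int.fract (1 / x))|
  have hs : 0 ≤ s := abs_nonneg _
  have h1 : Real.exp (3 / 4 * |gPartial n x|) ≤
      x ^ (-(3 / 4 : ℝ)) * (Real.exp (3 / 4 * C) * Real.exp (3 / 8 * s)) := by
    rw [Real.rpow_def_of_pos hx0, ← Real.exp_add, ← Real.exp_add]
    refine Real.exp_le_exp.2 ?_
    nlinarith
  refine h1.trans ?_
  gcongr
  have h2 : Real.exp (3 / 4 * s) = Real.exp (3 / 8 * s) ^ 2 := by
    rw [← Real.exp_nat_mul]; congr 1; push_cast; ring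
  rw [h2]
  set y := Real.exp (3 / 8 * s)
  have h3 : 0 ≤ (ε * y - 1) ^ 2 / ε + y := by positivity
  have h4 : ε * y ^ 2 + 1 / ε - y = (ε * y - 1) ^ 2 / ε + y := by field_simp; ring
  linarith

theorem lintegral_expMaximal_lt_top : ∫⁻ x in Ioo (0 : ℝ) 1, expMaximal x < ⊤ := by
  obtain ⟨C, -, hC⟩ := exists_abs_gPartial_le
  set σ : ℝ := ∑' n : ℕ, ((n : ℝ) + 2) ^ (3 / 4 - 2 : ℝ)
  have hsum : Summable fun n : ℕ => ((n : ℝ) + 2) ^ (3 / 4 - 2 : ℝ) :=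
    summable_natCast_add_two_rpow (by norm_num)
  have hσ : 0 < σ := hsum.tsum_pos (fun n => by positivity) 0 (by positivity)
  set c := Real.exp (3 / 4 * C)
  have hc : 0 < c := Real.exp_pos _
  set ε : ℝ := 1 / (4 * σ * c)
  have hε : 0 < ε := by positivity
  have key : ∀ N, ∫⁻ x in Ioo (0 : ℝ) 1, expPartialMax N x ≤
      ENNReal.ofReal (4 * σ * c * (1 / ε)) := by
    intro N
    have hfin := lintegral_expPartialMax_lt_top N
    have h1 := lintegral_Ioo_zero_one_le_of_symm fun x hx => expPartialMax_one_sub N hx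
    have h2 : ∫⁻ x in Ioo (0 : ℝ) (1 / 2), expPartialMax N x ≤
        ∫⁻ x in Ioo (0 : ℝ) (1 / 2), ENNReal.ofReal (x ^ (-(3 / 4 : ℝ))) *
          (fun t => ENNReal.ofReal c * (ENNReal.ofReal ε * expPartialMax N t +
            ENNReal.ofReal (1 / ε))) (Int.fract (1 / x)) := by
      refine setLIntegral_mono_ae' measurableSet_Ioo ?_
      filter_upwards [ae_irrational] with x hx hmem
      exact expPartialMax_le hC hε N hx hmem.1 hmem.2
    have h3 := lintegral_rpow_mul_fract_inv_le (b := 3 / 4) (by norm_num)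
      (fun t => ENNReal.ofReal c * (ENNReal.ofReal ε * expPartialMax N t +
            ENNReal.ofReal (1 / ε)))
    rw [← ENNReal.ofReal_tsum_of_nonneg (fun n => by positivity) hsum,
      lintegral_const_mul' _ _ ENNReal.ofReal_ne_top,
      lintegral_add_right _ measurable_const, lintegral_const_mul' _ _ ENNReal.ofReal_ne_top] at h3
    simp only [lintegral_const, Measure.restrict_apply_univ, Real.volume_Ioo, sub_zero,
      ENNReal.ofReal_one, mul_one] at h3
    have h4 := h1.trans (mul_le_mul_right (h2.trans h3) 2)
    rw [← ENNReal.ofReal_toReal hfin.ne] at h4 ⊢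
    set a := (∫⁻ x in Ioo (0 : ℝ) 1, expPartialMax N x).toReal
    have ha : 0 ≤ a := ENNReal.toReal_nonneg
    rw [← ENNReal.ofReal_mul hε.le, ← ENNReal.ofReal_add (by positivity) (by positivity),
      ← ENNReal.ofReal_mul hc.le, ← ENNReal.ofReal_mul hσ.le,
      show (2 : ENNReal) = ENNReal.ofReal 2 by simp, ← ENNReal.ofReal_mul (by norm_num)] at h4
    rw [ENNReal.ofReal_le_ofReal_iff (by positivity)] at h4
    refine ENNReal.ofReal_le_ofReal ?_
    have h5 : 2 * (σ * (c * (ε * a + 1 / ε))) = a / 2 + 2 * σ * c * (1 / ε) := by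
      have : σ * c * ε = 1 / 4 := by simp only [ε]; field_simp
      linear_combination 2 * a * this
    linarith
  have hsup : ∀ x, expMaximal x = ⨆ N, expPartialMax N x := by
    intro x
    refine le_antisymm (iSup_le fun n => le_iSup_of_le n ?_) (iSup_le fun N => ?_)
    · exact Finset.le_sup' (fun n => expPartial n x) (Finset.self_mem_range_succ n)
    · exact Finset.sup'_le _ _ fun n _ => le_iSup (fun n => expPartial n x) n
  simp only [hsup]
  rw [lintegral_iSup]
  · exact (iSup_le key).trans_lt ENNReal.ofReal_lt_top
  · exact fun N => Finset.measurable_range_sup'' fun n _ => measurable_expPartial n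
  · intro M N hMN x
    exact Finset.sup'_mono _ (Finset.range_subset_range.2 (by omega)) _

/-- The oscillation at infinity of the partial sums of `gfun`. -/
noncomputable def gOscillation (x : ℝ) : ENNReal :=
  limsup (fun p : ℕ × ℕ => ENNReal.ofReal |gPartial p.1 x - gPartial p.2 x|) atTop

theorem measurable_gOscillation : Measurable gOscillation := by
  refine Measurable.limsup' (fun p => ?_) (p := fun _ : ℕ × ℕ => True) (s := Ici)
    ⟨atTop_basis, to_countable _⟩ fun _ => to_countable _
  have := measurable_gPartial p.1
  have := measurable_gPartial p.2
  fun_prop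

theorem gOscillation_one_sub {x : ℝ} (hx : Irrational x) :
    gOscillation (1 - x) = gOscillation x := by
  simp only [gOscillation, gPartial_one_sub _ hx, neg_sub_neg]
  congr 1
  ext p
  rw [abs_sub_comm]

theorem abs_gPartial_le_exp (n : ℕ) (x : ℝ) :
    ENNReal.ofReal |gPartial n x| ≤ ENNReal.ofReal (4 / 3) * expMaximal x := by
  refine le_trans ?_ (mul_le_mul_right (le_iSup (fun n => expPartial n x) n) _)
  rw [expPartial, ← ENNReal.ofReal_mul (by norm_num)]
  refine ENNReal.ofReal_le_ofReal ?_
  linarith [Real.add_one_le_exp (3 / 4 * |gPartial n x|)]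

theorem gOscillation_le_expMaximal (x : ℝ) :
    gOscillation x ≤ ENNReal.ofReal (8 / 3) * expMaximal x := by
  refine limsup_le_of_le (h := Eventually.of_forall fun p => ?_)
  refine (ENNReal.ofReal_le_ofReal (abs_sub _ _)).trans ?_
  rw [ENNReal.ofReal_add (abs_nonneg _) (abs_nonneg _)]
  refine (add_le_add (abs_gPartial_le_exp _ _) (abs_gPartial_le_exp _ _)).trans_eq ?_
  rw [← add_mul, ← ENNReal.ofReal_add (by norm_num) (by norm_num)]
  norm_num

theorem gOscillation_le_mul {x : ℝ} (hx : Irrational x) (hx0 : 0 < x) (hx1 : x < 1) :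
    gOscillation x ≤ ENNReal.ofReal x * gOscillation (Int.fract (1 / x)) := by
  obtain ⟨C, -, hC⟩ := exists_tendsto_gPartial_add
  obtain ⟨R, -, hR⟩ := hC x hx hx0 hx1
  set A : ℕ → ℝ := fun N => gPartial N x + x * gPartial ⌊N * x⌋₊ (Int.fract (1 / x)) with hA
  have hM : Tendsto (fun N : ℕ => ⌊(N : ℝ) * x⌋₊) atTop atTop :=
    tendsto_nat_floor_atTop.comp (tendsto_natCast_atTop_atTop.atTop_mul_const hx0)
  have hMM : Tendsto (fun p : ℕ × ℕ => (⌊(p.1 : ℝ) * x⌋₊, ⌊(p.2 : ℝ) * x⌋₊)) atTop atTop := by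
    rw [← prod_atTop_atTop_eq]
    exact hM.prodMap hM
  have hAA : Tendsto (fun p : ℕ × ℕ => |A p.1 - A p.2|) atTop (nhds 0) := by
    rw [← prod_atTop_atTop_eq]
    have := ((hR.comp tendsto_fst).sub (hR.comp (tendsto_snd (f := atTop (α := ℕ))))).abs
    simpa using this
  have hle : ∀ p : ℕ × ℕ, ENNReal.ofReal |gPartial p.1 x - gPartial p.2 x| ≤
      ENNReal.ofReal |A p.1 - A p.2| + ENNReal.ofReal x *
        ENNReal.ofReal |gPartial ⌊p.1 * x⌋₊ (Int.fract (1 / x)) -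
          gPartial ⌊p.2 * x⌋₊ (Int.fract (1 / x))| := by
    intro p
    rw [← ENNReal.ofReal_mul hx0.le, ← ENNReal.ofReal_add (abs_nonneg _) (by positivity)]
    refine ENNReal.ofReal_le_ofReal ?_
    have e : ∀ d : ℝ, x * |d| = |x * d| := fun d => by rw [abs_mul, abs_of_pos hx0]
    rw [e]
    refine le_trans (le_of_eq ?_) (abs_sub _ _)
    congr 1
    simp only [hA]
    ring
  have hAA' := ENNReal.tendsto_ofReal hAA
  rw [ENNReal.ofReal_zero] at hAA'
  set G : ℕ × ℕ → ENNReal := fun q => ENNReal.ofReal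
    |gPartial q.1 (Int.fract (1 / x)) - gPartial q.2 (Int.fract (1 / x))| with hG
  have h1 : gOscillation x ≤ limsup ((fun p : ℕ × ℕ => ENNReal.ofReal |A p.1 - A p.2|) +
      fun p : ℕ × ℕ => ENNReal.ofReal x * G (⌊(p.1 : ℝ) * x⌋₊, ⌊(p.2 : ℝ) * x⌋₊)) atTop :=
    limsup_le_limsup (Eventually.of_forall hle)
  refine h1.trans ?_
  rw [ENNReal.limsup_add_of_left_tendsto_zero hAA',
    ENNReal.limsup_const_mul_of_ne_top ENNReal.ofReal_ne_top]
  gcongr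
  exact (limsup_comp G _ _).trans_le (limsup_le_limsup_of_le hMM)

theorem ae_gOscillation_eq_zero : ∀ᵐ x ∂volume.restrict (Ioo (0 : ℝ) 1), gOscillation x = 0 := by
  have hfin : ∫⁻ x in Ioo (0 : ℝ) 1, gOscillation x < ⊤ := by
    refine (lintegral_mono gOscillation_le_expMaximal).trans_lt ?_
    rw [lintegral_const_mul' _ _ ENNReal.ofReal_ne_top]
    exact ENNReal.mul_lt_top ENNReal.ofReal_lt_top lintegral_expMaximal_lt_top
  have hsum : HasSum (fun n : ℕ => ((n : ℝ) + 2) ^ (0 - 2 : ℝ)) (Real.pi ^ 2 / 6 - 1) := by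
    have := (hasSum_nat_add_iff' 2).2 hasSum_zeta_two
    simp only [Finset.sum_range_succ, Finset.sum_range_zero] at this
    norm_num at this
    have e : (fun n : ℕ => ((n : ℝ) + 2) ^ (0 - 2 : ℝ)) = fun n : ℕ => (((n : ℝ) + 2) ^ 2)⁻¹ := by
      ext n
      rw [zero_sub, Real.rpow_neg (by positivity), Real.rpow_two]
    rwa [e]
  have h1 := lintegral_Ioo_zero_one_le_of_symm fun x hx => gOscillation_one_sub hx
  have h2 : ∫⁻ x in Ioo (0 : ℝ) (1 / 2), gOscillation x ≤
      ∫⁻ x in Ioo (0 : ℝ) (1 / 2), ENNReal.ofReal (x ^ (-0 : ℝ)) *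
        (fun t => ENNReal.ofReal (1 / 2) * gOscillation t) (Int.fract (1 / x)) := by
    refine setLIntegral_mono_ae' measurableSet_Ioo ?_
    filter_upwards [ae_irrational] with x hx hmem
    refine (gOscillation_le_mul hx hmem.1 (by linarith [hmem.2])).trans ?_
    rw [neg_zero, Real.rpow_zero, ENNReal.ofReal_one, one_mul]
    gcongr
    exact hmem.2.le
  have h3 := lintegral_rpow_mul_fract_inv_le (b := 0) (by norm_num)
    (fun t => ENNReal.ofReal (1 / 2) * gOscillation t)
  rw [← ENNReal.ofReal_tsum_of_nonneg (fun n => by positivity) hsum.summable, hsum.tsum_eq,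
    lintegral_const_mul' _ _ ENNReal.ofReal_ne_top] at h3
  have h4 := h1.trans (mul_le_mul_right (h2.trans h3) 2)
  have hpi : 0 ≤ Real.pi ^ 2 / 6 - 1 := by nlinarith [Real.pi_gt_three]
  have hpi2 : Real.pi ^ 2 / 6 - 1 < 1 := by nlinarith [Real.pi_lt_d2, Real.pi_pos]
  rw [← ENNReal.ofReal_toReal hfin.ne] at h4
  set a := (∫⁻ x in Ioo (0 : ℝ) 1, gOscillation x).toReal with ha_def
  have ha : 0 ≤ a := ENNReal.toReal_nonneg
  rw [← ENNReal.ofReal_mul (by norm_num), ← ENNReal.ofReal_mul hpi,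
    show (2 : ENNReal) = ENNReal.ofReal 2 by simp, ← ENNReal.ofReal_mul (by norm_num),
    ENNReal.ofReal_le_ofReal_iff (by positivity)] at h4
  have ha0 : a = 0 := by nlinarith
  rw [ha_def, ENNReal.toReal_eq_zero_iff] at ha0
  have := ha0.resolve_right hfin.ne
  exact (lintegral_eq_zero_iff measurable_gOscillation).1 this

theorem tendsto_gPartial_of_gOscillation {x : ℝ} (hx : gOscillation x = 0) :
    Tendsto (fun N => gPartial N x) atTop (nhds (gfun x)) := by
  have hc : CauchySeq fun N => gPartial N x := by
    rw [Metric.cauchySeq_iff]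
    intro ε hε
    have hlt : gOscillation x < ENNReal.ofReal ε := by
      rw [hx]; exact ENNReal.ofReal_pos.2 hε
    obtain ⟨⟨p, q⟩, hpq⟩ := eventually_atTop.1 (eventually_lt_of_limsup_lt hlt)
    refine ⟨max p q, fun m hm n hn => ?_⟩
    have := hpq (m, n) ⟨(le_max_left _ _).trans hm, (le_max_right _ _).trans hn⟩
    exact (ENNReal.ofReal_lt_ofReal_iff hε).1 this
  obtain ⟨y, hy⟩ := cauchySeq_tendsto_of_complete hc
  rw [show gfun x = y from hy.limUnder_eq]
  exact hy

theorem rpow_le_Gamma_mul_exp {y K : ℝ} (hy : 0 ≤ y) (hK : 0 < K) :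
    y ^ K ≤ Real.Gamma (K + 1) * Real.exp y := by
  have hint := Real.GammaIntegral_convergent (s := K + 1) (by linarith)
  have hsub : Ioi y ⊆ Ioi 0 := Ioi_subset_Ioi hy
  have h1 : ∫ t in Ioi y, Real.exp (-t) * y ^ K ≤ Real.Gamma (K + 1) := by
    rw [Real.Gamma_eq_integral (by linarith)]
    refine le_trans ?_ (setIntegral_mono_set hint ?_ hsub.eventuallyLE)
    · refine setIntegral_mono_on ((integrableOn_exp_neg_Ioi y).mul_const _) (hint.mono_set hsub)
        measurableSet_Ioi fun t ht => ?_
      rw [add_sub_cancel_right]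
      have : y ≤ t := (mem_Ioi.1 ht).le
      gcongr
    · filter_upwards [ae_restrict_mem measurableSet_Ioi] with t ht
      have : 0 < t := ht
      simp only [Pi.zero_apply]
      positivity
  rw [integral_mul_const, integral_exp_neg_Ioi] at h1
  calc y ^ K = (Real.exp (-y) * y ^ K) * Real.exp y := by
        rw [mul_right_comm, ← Real.exp_add]; simp
    _ ≤ _ := by gcongr

theorem rpow_sub_rpow_le {p q K : ℝ} (hp : 0 ≤ p) (hpq : p ≤ q) (hK : 1 ≤ K) :
    q ^ K - p ^ K ≤ K * (q - p) * q ^ (K - 1) := by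
  rcases hp.eq_or_lt with rfl | hp'
  · rcases hpq.eq_or_lt with rfl | hq
    · simp
    · rw [Real.zero_rpow (by linarith), sub_zero, sub_zero, mul_assoc]
      have : q ^ K = q * q ^ (K - 1) := by
        rw [Real.rpow_sub_one hq.ne']; field_simp
      rw [← this]
      exact le_mul_of_one_le_left (by positivity) hK
  · have hq : 0 < q := hp'.trans_le hpq
    have h := one_add_mul_self_le_rpow_one_add (s := p / q - 1)
      (by linarith [div_nonneg hp hq.le]) hK
    rw [add_sub_cancel, Real.div_rpow hp hq.le] at h
    rw [Real.rpow_sub_one hq.ne']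
    have hqK : 0 < q ^ K := by positivity
    rw [le_div_iff₀ hqK] at h
    have e : (1 + K * (p / q - 1)) * q ^ K = q ^ K - K * (q - p) * (q ^ K / q) := by
      field_simp; ring
    rw [e] at h
    linarith

theorem abs_rpow_sub_rpow_le {p q d K β : ℝ} (hp : 0 ≤ p) (hq : 0 ≤ q) (hd : |p - q| ≤ d)
    (hK : 1 < K) (hβ : 0 < β) :
    |p ^ K - q ^ K| ≤ Real.Gamma (K + 1) * β ^ (1 - K) * (d * Real.exp (β * (q + d))) := by
  have hd0 : 0 ≤ d := (abs_nonneg _).trans hd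
  have hmain : |p ^ K - q ^ K| ≤ K * d * (q + d) ^ (K - 1) := by
    rw [abs_le] at hd
    have hpd : p ≤ q + d := by linarith
    have hqd : q ≤ q + d := by linarith
    rcases le_total p q with h | h
    · rw [abs_sub_comm, abs_of_nonneg (sub_nonneg.2 (by gcongr))]
      refine (rpow_sub_rpow_le hp h hK.le).trans ?_
      gcongr
      linarith
    · rw [abs_of_nonneg (sub_nonneg.2 (by gcongr))]
      refine (rpow_sub_rpow_le hq h hK.le).trans ?_
      gcongr
      linarith
  refine hmain.trans ?_
  have hy : 0 ≤ q + d := by positivity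
  have hG := rpow_le_Gamma_mul_exp (y := β * (q + d)) (K := K - 1) (by positivity) (by linarith)
  rw [sub_add_cancel, Real.mul_rpow hβ.le hy] at hG
  rw [Real.Gamma_add_one (by linarith)]
  have hb : β ^ (1 - K) * β ^ (K - 1) = 1 := by
    rw [← Real.rpow_add hβ]; simp
  calc K * d * (q + d) ^ (K - 1)
      = K * d * β ^ (1 - K) * (β ^ (K - 1) * (q + d) ^ (K - 1)) := by
        linear_combination -(K * d * (q + d) ^ (K - 1)) * hb
    _ ≤ K * d * β ^ (1 - K) * (Real.Gamma K * Real.exp (β * (q + d))) := by gcongr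
    _ = _ := by ring

theorem integral_log_div_rpow {a K : ℝ} (ha : 0 < a) (hK : 0 < K) :
    IntegrableOn (fun x => Real.log (a / x) ^ K) (Ioo 0 a) ∧
      ∫ x in Ioo 0 a, Real.log (a / x) ^ K = a * Real.Gamma (K + 1) := by
  have himg : (fun u : ℝ => a * Real.exp (-u)) '' Ioi 0 = Ioo 0 a := by
    ext x
    simp only [mem_image, mem_Ioi, mem_Ioo]
    constructor
    · rintro ⟨u, hu, rfl⟩
      refine ⟨by positivity, mul_lt_of_lt_one_right ha ((Real.exp_lt_exp.2 (by linarith)).trans_eq Real.exp_zero)⟩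
    · rintro ⟨h0, h1⟩
      refine ⟨Real.log (a / x), Real.log_pos ((one_lt_div h0).2 h1), ?_⟩
      rw [Real.exp_neg, Real.exp_log (by positivity)]
      field_simp
  have hd : ∀ u ∈ Ioi (0 : ℝ), HasDerivWithinAt (fun u : ℝ => a * Real.exp (-u))
      (-(a * Real.exp (-u))) (Ioi 0) u := by
    intro u _
    have := ((Real.hasDerivAt_exp (-u)).comp u (hasDerivAt_neg u)).const_mul a
    refine this.hasDerivWithinAt.congr_deriv ?_
    ring
  have hinj : InjOn (fun u : ℝ => a * Real.exp (-u)) (Ioi 0) := by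
    intro u _ v _ h
    simpa [ha.ne'] using h
  have hfun : ∀ u : ℝ, |-(a * Real.exp (-u))| • Real.log (a / (a * Real.exp (-u))) ^ K =
      a * (Real.exp (-u) * u ^ (K + 1 - 1)) := by
    intro u
    have : a / (a * Real.exp (-u)) = Real.exp u := by
      rw [Real.exp_neg]; field_simp
    rw [this, Real.log_exp, abs_neg, abs_of_pos (by positivity), smul_eq_mul, add_sub_cancel_right,
      mul_assoc]
  rw [← himg, integrableOn_image_iff_integrableOn_abs_deriv_smul measurableSet_Ioi hd hinj,
    integral_image_eq_integral_abs_deriv_smul measurableSet_Ioi hd hinj]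
  simp only [hfun]
  rw [integral_const_mul, Real.Gamma_eq_integral (by linarith)]
  exact ⟨(Real.GammaIntegral_convergent (by linarith)).const_mul a, rfl⟩

/-- The point where the main term `logTerm` vanishes. -/
noncomputable def logTermZero : ℝ := Real.exp Real.eulerMascheroniConstant / (2 * Real.pi)

theorem logTermZero_pos : 0 < logTermZero := by
  unfold logTermZero
  positivity

theorem logTermZero_lt_half : logTermZero < 1 / 2 := by
  have h1 : Real.exp Real.eulerMascheroniConstant < 3 :=
    (Real.exp_lt_exp.2 (Real.eulerMascheroniConstant_lt_two_thirds.trans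
      (by norm_num : (2 / 3 : ℝ) < 1))).trans Real.exp_one_lt_three
  rw [logTermZero, div_lt_iff₀ (by positivity)]
  linarith [Real.pi_gt_three]

theorem logTerm_eq {x : ℝ} (hx : 0 < x) : logTerm x = Real.log (logTermZero / x) := by
  rw [logTerm, logTermZero, Real.log_div (by positivity) hx.ne', Real.log_div (by positivity)
    (by positivity), Real.log_exp]
  ring

theorem integral_max_logTerm_rpow {K : ℝ} (hK : 0 < K) :
    IntegrableOn (fun x => max (logTerm x) 0 ^ K) (Ioo 0 (1 / 2)) ∧
      ∫ x in Ioo 0 (1 / 2), max (logTerm x) 0 ^ K = logTermZero * Real.Gamma (K + 1) := by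
  obtain ⟨h1, h2⟩ := integral_log_div_rpow logTermZero_pos hK
  have hsub : Ioo 0 logTermZero ⊆ Ioo 0 (1 / 2) := Ioo_subset_Ioo_right logTermZero_lt_half.le
  have heq : EqOn (fun x => max (logTerm x) 0 ^ K) (fun x => Real.log (logTermZero / x) ^ K)
      (Ioo 0 logTermZero) := by
    intro x hx
    have : 0 ≤ Real.log (logTermZero / x) := Real.log_nonneg ((one_le_div hx.1).2 hx.2.le)
    simp only [logTerm_eq hx.1, max_eq_left this]
  have hzero : ∀ x ∈ Ioo (0 : ℝ) (1 / 2) \ Ioo 0 logTermZero, max (logTerm x) 0 ^ K = 0 := by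
    rintro x ⟨hx, hx'⟩
    have hax : logTermZero ≤ x := by
      by_contra h
      exact hx' ⟨hx.1, not_le.1 h⟩
    have : Real.log (logTermZero / x) ≤ 0 :=
      Real.log_nonpos (div_nonneg logTermZero_pos.le hx.1.le) ((div_le_one hx.1).2 hax)
    rw [logTerm_eq hx.1, max_eq_right this, Real.zero_rpow hK.ne']
  constructor
  · exact (h1.congr_fun heq.symm measurableSet_Ioo).of_forall_sdiff_eq_zero measurableSet_Ioo hzero
  · rw [setIntegral_eq_of_subset_of_forall_sdiff_eq_zero measurableSet_Ioo hsub hzero,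
      setIntegral_congr_fun measurableSet_Ioo heq, h2]

/-- The integrable majorant of the error in the approximation of `gfun` by `logTerm`. -/
noncomputable def errorWeight (x : ℝ) : ℝ :=
  x ^ (-(3 / 4 : ℝ)) * (expMaximal (Int.fract (1 / x))).toReal

theorem lintegral_rpow_mul_expMaximal_lt_top :
    ∫⁻ x in Ioo (0 : ℝ) (1 / 2), ENNReal.ofReal (x ^ (-(3 / 4 : ℝ))) *
      expMaximal (Int.fract (1 / x)) < ⊤ := by
  refine (lintegral_rpow_mul_fract_inv_le (b := 3 / 4) (by norm_num) expMaximal).trans_lt ?_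
  refine ENNReal.mul_lt_top ?_ lintegral_expMaximal_lt_top
  rw [← ENNReal.ofReal_tsum_of_nonneg (fun n => by positivity)
    (summable_natCast_add_two_rpow (by norm_num))]
  exact ENNReal.ofReal_lt_top

theorem measurable_expMaximal_fract : Measurable fun x : ℝ => expMaximal (Int.fract (1 / x)) :=
  measurable_expMaximal.comp (by fun_prop)

theorem integrableOn_errorWeight : IntegrableOn errorWeight (Ioo 0 (1 / 2)) := by
  refine ⟨?_, ?_⟩
  · have := measurable_expMaximal_fract
    refine Measurable.aestronglyMeasurable ?_
    unfold errorWeight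
    fun_prop
  · refine lt_of_le_of_lt (setLIntegral_mono' measurableSet_Ioo fun x hx => ?_)
      lintegral_rpow_mul_expMaximal_lt_top
    have hx0 : 0 < x := hx.1
    rw [errorWeight, enorm_mul, Real.enorm_of_nonneg (by positivity),
      Real.enorm_of_nonneg (by positivity)]
    gcongr
    exact ENNReal.ofReal_toReal_le

theorem ae_expMaximal_fract_lt_top :
    ∀ᵐ x ∂volume.restrict (Ioo (0 : ℝ) (1 / 2)), expMaximal (Int.fract (1 / x)) < ⊤ := by
  have hm : Measurable fun x : ℝ => ENNReal.ofReal (x ^ (-(3 / 4 : ℝ))) *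
      expMaximal (Int.fract (1 / x)) :=
    Measurable.mul (by fun_prop) measurable_expMaximal_fract
  filter_upwards [ae_lt_top hm lintegral_rpow_mul_expMaximal_lt_top.ne,
    ae_restrict_mem measurableSet_Ioo] with x hx hmem
  have hx0 : 0 < x := hmem.1
  refine lt_top_iff_ne_top.2 fun h => ?_
  rw [h, ENNReal.mul_top (by simpa using by positivity)] at hx
  exact lt_irrefl _ hx

theorem abs_gPartial_le_log {t : ℝ} (ht : expMaximal t < ⊤) (n : ℕ) :
    |gPartial n t| ≤ 4 / 3 * Real.log (expMaximal t).toReal := by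
  have h : expPartial n t ≤ expMaximal t := le_iSup (fun n => expPartial n t) n
  have h1 := (ENNReal.ofReal_le_iff_le_toReal ht.ne).1 h
  have h2 := (Real.le_log_iff_exp_le ((Real.exp_pos _).trans_le h1)).2 h1
  linarith

theorem exists_abs_rpow_gfun_sub_le : ∃ D, 0 < D ∧ ∀ x : ℝ, Irrational x → 0 < x → x < 1 / 2 →
    gOscillation x = 0 → expMaximal (Int.fract (1 / x)) < ⊤ → ∀ K : ℝ, 1 < K →
    |(|gfun x| ^ K) - max (logTerm x) 0 ^ K| ≤
      Real.Gamma (K + 1) * (9 / 8) ^ (1 - K) * (D * errorWeight x) := by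
  obtain ⟨C, hC0, hC⟩ := exists_tendsto_gPartial_add
  set c₁ := |Real.eulerMascheroniConstant - Real.log (2 * Real.pi)| with hc₁
  refine ⟨16 / 3 * Real.exp (9 / 8 * c₁ + 3 / 4 * (C + 1 / logTermZero)), by positivity,
    fun x hx hx0 hx1 hosc hE K hK => ?_⟩
  obtain ⟨R, hR, hlim⟩ := hC x hx hx0 (by linarith)
  have hV := abs_gPartial_le_log hE
  have hEpos : 0 < (expMaximal (Int.fract (1 / x))).toReal := by
    refine ENNReal.toReal_pos ?_ hE.ne
    refine ((?_ : 0 < expPartial 0 (Int.fract (1 / x))).trans_le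
      (le_iSup (fun n => expPartial n (Int.fract (1 / x))) 0)).ne'
    exact ENNReal.ofReal_pos.2 (Real.exp_pos _)
  set V := 4 / 3 * Real.log (expMaximal (Int.fract (1 / x))).toReal with hVdef
  have hV0 : 0 ≤ V := (abs_nonneg _).trans (hV 0)
  have ha := logTermZero_pos
  set U := C + 1 / logTermZero + V with hU
  have hU0 : 0 ≤ U := by positivity
  have hg : |gfun x - logTerm x| ≤ x * (C + V) := by
    have h1 := (hlim.sub (tendsto_gPartial_of_gOscillation hosc)).abs
    have h2 : |logTerm x + R - gfun x| ≤ x * V := by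
      refine le_of_tendsto h1 (Eventually.of_forall fun N => ?_)
      rw [add_sub_cancel_left, abs_mul, abs_of_pos hx0]
      gcongr
      exact hV _
    rw [abs_le] at *
    constructor <;> linarith [hR.1, hR.2, h2.1, h2.2]
  have hL : |logTerm x - max (logTerm x) 0| ≤ x * (1 / logTermZero) := by
    have h1 : -(x / logTermZero) ≤ logTerm x := by
      have := Real.one_sub_inv_le_log_of_pos (div_pos ha hx0)
      rw [← logTerm_eq hx0, inv_div] at this
      linarith
    have h2 : 0 ≤ x / logTermZero := by positivity
    rw [mul_one_div, abs_le]
    rcases le_total (logTerm x) 0 with h | h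
    · rw [max_eq_right h]; constructor <;> linarith
    · rw [max_eq_left h]; constructor <;> linarith
  have hd : |(|gfun x|) - max (logTerm x) 0| ≤ x * U := by
    have h1 := abs_abs_sub_abs_le (gfun x) (max (logTerm x) 0)
    rw [abs_of_nonneg (le_max_right (logTerm x) 0)] at h1
    refine h1.trans ((abs_sub_le _ (logTerm x) _).trans ?_)
    linarith
  refine (abs_rpow_sub_rpow_le (abs_nonneg _) (le_max_right _ _) hd hK
    (by norm_num : (0 : ℝ) < 9 / 8)).trans ?_
  have hG := Real.Gamma_pos_of_pos (by linarith : 0 < K + 1)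
  refine mul_le_mul_of_nonneg_left ?_ (by positivity)
  have hlog : Real.log x ≤ 0 := Real.log_nonpos hx0.le (by linarith)
  have hLub : max (logTerm x) 0 ≤ -Real.log x + c₁ := by
    refine max_le ?_ (by have := abs_nonneg (Real.eulerMascheroniConstant -
      Real.log (2 * Real.pi)); linarith)
    have := le_abs_self (Real.eulerMascheroniConstant - Real.log (2 * Real.pi))
    rw [logTerm]
    linarith
  have hUexp : U ≤ 16 / 3 * Real.exp (3 / 16 * U) := by
    linarith [Real.add_one_le_exp (3 / 16 * U)]
  have hE' : (expMaximal (Int.fract (1 / x))).toReal = Real.exp (3 / 4 * V) := by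
    have h : 3 / 4 * V = Real.log (expMaximal (Int.fract (1 / x))).toReal := by
      rw [hVdef]; ring
    rw [h, Real.exp_log hEpos]
  have hw : errorWeight x = Real.exp (Real.log x * -(3 / 4)) * Real.exp (3 / 4 * V) := by
    unfold errorWeight
    rw [hE', Real.rpow_def_of_pos hx0]
  rw [hw]
  have hxexp : x = Real.exp (Real.log x) := (Real.exp_log hx0).symm
  have hxU : x * U ≤ U / 2 := by nlinarith
  calc x * U * Real.exp (9 / 8 * (max (logTerm x) 0 + x * U))
      ≤ Real.exp (Real.log x) * (16 / 3 * Real.exp (3 / 16 * U)) *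
        Real.exp (9 / 8 * ((-Real.log x + c₁) + U / 2)) := by
        rw [← hxexp]
        gcongr
    _ = 16 / 3 * Real.exp (Real.log x + 3 / 16 * U + 9 / 8 * ((-Real.log x + c₁) + U / 2)) := by
        rw [Real.exp_add, Real.exp_add]; ring
    _ ≤ 16 / 3 * Real.exp (9 / 8 * c₁ + 3 / 4 * (C + 1 / logTermZero) +
        (Real.log x * -(3 / 4) + 3 / 4 * V)) := by
        refine mul_le_mul_of_nonneg_left (Real.exp_le_exp.2 ?_) (by norm_num)
        linarith
    _ = _ := by
        rw [Real.exp_add _ (Real.log x * -(3 / 4) + 3 / 4 * V), Real.exp_add (Real.log x * _)]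
        ring

theorem gfun_one_sub {x : ℝ} (hx : Irrational x) (hosc : gOscillation x = 0) :
    gfun (1 - x) = -gfun x := by
  have h := (tendsto_gPartial_of_gOscillation hosc).neg
  simp only [← gPartial_one_sub _ hx] at h
  exact h.limUnder_eq

theorem integral_Ioo_zero_one_of_symm {f : ℝ → ℝ} (hint : IntegrableOn f (Ioo 0 (1 / 2)))
    (hf : ∀ᵐ x ∂volume.restrict (Ioo (0 : ℝ) (1 / 2)), f (1 - x) = f x) :
    ∫ x in Ioo (0 : ℝ) 1, f x = 2 * ∫ x in Ioo (0 : ℝ) (1 / 2), f x := by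
  have hd : ∀ t ∈ Ioo (0 : ℝ) (1 / 2), HasDerivWithinAt (fun t : ℝ => 1 - t)
      (-1) (Ioo 0 (1 / 2)) t := fun t _ => ((hasDerivAt_id t).const_sub 1).hasDerivWithinAt
  have hinj : InjOn (fun t : ℝ => 1 - t) (Ioo 0 (1 / 2)) := fun s _ t _ h => by simpa using h
  have hae : (fun x => |(-1 : ℝ)| • f (1 - x)) =ᵐ[volume.restrict (Ioo (0 : ℝ) (1 / 2))] f := by
    filter_upwards [hf] with x hx
    simp [hx]
  have hint2 : IntegrableOn f (Ioo (1 / 2) 1) := by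
    rw [← image_one_sub_Ioo_zero_half,
      integrableOn_image_iff_integrableOn_abs_deriv_smul measurableSet_Ioo hd hinj]
    exact hint.congr hae.symm
  have heq : ∫ x in Ioo (1 / 2 : ℝ) 1, f x = ∫ x in Ioo (0 : ℝ) (1 / 2), f x := by
    rw [← image_one_sub_Ioo_zero_half,
      integral_image_eq_integral_abs_deriv_smul measurableSet_Ioo hd hinj]
    exact integral_congr_ae hae
  have hdisj : Disjoint (Ioo (0 : ℝ) (1 / 2)) (Ioo (1 / 2 : ℝ) 1) := by
    rw [Set.disjoint_left]
    intro x hx hx'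
    exact lt_asymm hx.2 hx'.1
  rw [setIntegral_congr_set ae_Ioo_zero_one_le, setIntegral_union hdisj measurableSet_Ioo hint
    hint2, heq, two_mul]

theorem moment_asymptotics :
    ∃ C > 0, ∃ c > 0, ∃ K₀ > 0, ∀ K : ℝ, K ≥ K₀ →
      |(∫ x in Ioo (0:ℝ) 1, |gfun x| ^ K) -
          Real.exp Real.eulerMascheroniConstant / Real.pi * Real.Gamma (K + 1)| ≤
        c * Real.Gamma (K + 1) * Real.exp (-C * K) := by
  obtain ⟨D, hD, hpt⟩ := exists_abs_rpow_gfun_sub_le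
  set W := ∫ x in Ioo (0 : ℝ) (1 / 2), errorWeight x with hW
  have hW0 : 0 ≤ W := setIntegral_nonneg measurableSet_Ioo fun x hx => by
    have := hx.1
    unfold errorWeight
    positivity
  refine ⟨Real.log (9 / 8), Real.log_pos (by norm_num), 2 * (9 / 8) * (D * W) + 1, by positivity,
    2, by norm_num, fun K hK => ?_⟩
  have hG := Real.Gamma_pos_of_pos (by linarith : 0 < K + 1)
  obtain ⟨hLint, hLeq⟩ := integral_max_logTerm_rpow (by linarith : 0 < K)
  have hosc : ∀ᵐ x ∂volume.restrict (Ioo (0 : ℝ) (1 / 2)), gOscillation x = 0 :=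
    ae_restrict_of_ae_restrict_of_subset (Ioo_subset_Ioo_right (by norm_num))
      ae_gOscillation_eq_zero
  have hirr : ∀ᵐ x ∂volume.restrict (Ioo (0 : ℝ) (1 / 2)), Irrational x :=
    ae_restrict_of_ae ae_irrational
  have hmeas : AEStronglyMeasurable gfun (volume.restrict (Ioo (0 : ℝ) (1 / 2))) :=
    aestronglyMeasurable_of_tendsto_ae atTop
      (fun N => (measurable_gPartial N).aestronglyMeasurable)
      (hosc.mono fun x hx => tendsto_gPartial_of_gOscillation hx)
  have hmeasK : AEStronglyMeasurable (fun x => |gfun x| ^ K)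
      (volume.restrict (Ioo (0 : ℝ) (1 / 2))) :=
    (hmeas.norm.aemeasurable.pow_const K).aestronglyMeasurable
  have hbound : ∀ᵐ x ∂volume.restrict (Ioo (0 : ℝ) (1 / 2)),
      ‖|gfun x| ^ K - max (logTerm x) 0 ^ K‖ ≤
        Real.Gamma (K + 1) * (9 / 8) ^ (1 - K) * (D * errorWeight x) := by
    filter_upwards [hosc, hirr, ae_expMaximal_fract_lt_top, ae_restrict_mem measurableSet_Ioo]
      with x h1 h2 h3 h4
    exact hpt x h2 h4.1 h4.2 h1 h3 K (by linarith)
  have hBint := (integrableOn_errorWeight.const_mul D).const_mul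
    (Real.Gamma (K + 1) * (9 / 8) ^ (1 - K))
  have hdiff : IntegrableOn (fun x => |gfun x| ^ K - max (logTerm x) 0 ^ K) (Ioo 0 (1 / 2)) :=
    Integrable.mono' hBint (hmeasK.sub hLint.aestronglyMeasurable) hbound
  have hgint : IntegrableOn (fun x => |gfun x| ^ K) (Ioo 0 (1 / 2)) := by
    refine (hdiff.add hLint).congr (Eventually.of_forall fun x => by simp)
  have hsymm : ∀ᵐ x ∂volume.restrict (Ioo (0 : ℝ) (1 / 2)),
      |gfun (1 - x)| ^ K = |gfun x| ^ K := by
    filter_upwards [hosc, hirr] with x h1 h2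
    rw [gfun_one_sub h2 h1, abs_neg]
  have hmain := norm_integral_le_of_norm_le hBint hbound
  rw [integral_sub hgint hLint, hLeq, integral_const_mul, integral_const_mul, ← hW,
    Real.norm_eq_abs] at hmain
  rw [integral_Ioo_zero_one_of_symm hgint hsymm]
  have hconst : Real.exp Real.eulerMascheroniConstant / Real.pi = 2 * logTermZero := by
    rw [logTermZero]; field_simp
  have hpow : (9 / 8 : ℝ) ^ (1 - K) = 9 / 8 * Real.exp (-Real.log (9 / 8) * K) := by
    rw [Real.rpow_sub (by norm_num), Real.rpow_one, Real.rpow_def_of_pos (by norm_num), neg_mul,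
      Real.exp_neg]
    rfl
  rw [hpow] at hmain
  rw [hconst, mul_assoc, ← mul_sub, abs_mul, abs_two]
  have hpos : 0 < Real.Gamma (K + 1) * Real.exp (-Real.log (9 / 8) * K) := by positivity
  linarith
end
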